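/- There is no simple graph G on exactly 10 vertices with two longest paths P and Q satisfying all of the following: V(G) = V(P) ∪ V(Q); |V(P) ∩ V(Q)| = 6; V(P) \ V(Q) consists of two vertices that are consecutive on P; V(Q) \ V(P) = {c, d} where cd is not an edge of G; the subgraph of G induced on (V(P) \ V(Q)) ∪ {c, d} is connected; and no endpoint of P lies in V(P) \ V(Q) and no endpoint of Q lies in {c, d}. -/

import Mathlib

open SimpleGraph

/-- `P` is a longest path in the simple graph `G`: it is a path, and every path in `G`
has length at most the length of `P`. -/
def IsLongestPath {V : Type*} (G : SimpleGraph V) {u v : V} (P : G.Walk u v) : Prop :=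
  P.IsPath ∧ ∀ {a b : V} (Q : G.Walk a b), Q.IsPath → Q.length ≤ P.length

/-- The relation on `Fin 10` whose pairs are those of the path `0 - 1 - ... - 7`, extended by
joining each first component of an element of `l` to the vertices in the second. -/
def Traced (l : List (Fin 10 × List (Fin 10))) (u v : Fin 10) : Prop :=
  (u < 7 ∧ v = u + 1) ∨ (v < 7 ∧ u = v + 1) ∨
    ∃ p ∈ l, (u = p.1 ∧ v ∈ p.2) ∨ (v = p.1 ∧ u ∈ p.2)

instance (l : List (Fin 10 × List (Fin 10))) : DecidableRel (Traced l) := fun _ _ => by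
  unfold Traced
  infer_instance

/-- A family of orderings of nine of the ten vertices. At least one of them is a path as soon as
`8` and `9` are attached suitably to the path `0 - 1 - ... - 7`. -/
def ninePaths : List (List (Fin 10)) :=
  [[8, 0, 1, 2, 3, 4, 5, 6, 7], [8, 7, 6, 5, 4, 3, 2, 1, 0], [9, 7, 6, 5, 4, 3, 2, 1, 0],
    [9, 0, 1, 2, 3, 4, 5, 6, 7], [7, 6, 5, 4, 9, 3, 2, 1, 0], [7, 6, 9, 5, 4, 3, 2, 1, 0],
    [7, 6, 5, 4, 3, 2, 9, 1, 0], [7, 6, 5, 4, 3, 9, 2, 1, 0], [7, 6, 5, 9, 4, 3, 2, 1, 0],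
    [8, 5, 6, 9, 4, 3, 2, 1, 0], [8, 2, 1, 9, 3, 4, 5, 6, 7], [7, 6, 5, 4, 8, 3, 2, 1, 0],
    [7, 6, 8, 5, 4, 3, 2, 1, 0], [7, 6, 5, 4, 3, 2, 8, 1, 0], [9, 4, 5, 6, 8, 3, 2, 1, 0],
    [9, 3, 2, 1, 8, 4, 5, 6, 7], [9, 2, 3, 4, 5, 6, 8, 1, 0], [7, 6, 8, 1, 9, 5, 4, 3, 2],
    [7, 6, 9, 1, 8, 5, 4, 3, 2], [5, 6, 8, 2, 3, 4, 9, 1, 0]]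

lemma ninePaths_nodup_length : ∀ l ∈ ninePaths, l.Nodup ∧ l.length = 9 := by
  decide +kernel

/-- The pairs `x < y` of vertices of the path `0 - 1 - ... - 7` that avoid `k` and `k + 1`. -/
def commonPairs (k : Fin 10) : List (Fin 10 × Fin 10) :=
  ([0, 1, 2, 3, 4, 5, 6, 7] ×ˢ [0, 1, 2, 3, 4, 5, 6, 7]).filter fun q =>
    q.1 < q.2 ∧ q.1 ≠ k ∧ q.1 ≠ k + 1 ∧ q.2 ≠ k ∧ q.2 ≠ k + 1

lemma exists_isChain_ninePaths :
    ∀ k ∈ ([1, 2, 3, 4, 5] : List (Fin 10)), ∀ s ∈ [k, k + 1], ∀ q ∈ commonPairs k,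
      (∃ l ∈ ninePaths, l.IsChain (Traced [(8, [s, q.1, q.2])])) ∨
      ∀ t ∈ [k, k + 1], ∀ r ∈ commonPairs k, q ≠ r →
        ∃ l ∈ ninePaths, l.IsChain (Traced [(8, [s, q.1, q.2]), (9, [t, r.1, r.2])]) := by
  decide +kernel

namespace SimpleGraph.Walk

variable {V : Type*} {G : SimpleGraph V} {u v : V}

/-- A vertex of a path that is not an endpoint has two distinct neighbours on it. -/
lemma exists_getVert_pred_succ {p : G.Walk u v} {x : V} (hx : x ∈ p.support)
    (hu : x ≠ u) (hv : x ≠ v) :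
    ∃ i, i + 2 ≤ p.length ∧ p.getVert (i + 1) = x ∧
      G.Adj x (p.getVert i) ∧ G.Adj x (p.getVert (i + 2)) := by
  obtain ⟨n, rfl, hn⟩ := mem_support_iff_exists_getVert.1 hx
  have h0 : n ≠ 0 := by rintro rfl; simp at hu
  have h1 : n ≠ p.length := by rintro rfl; simp at hv
  obtain ⟨i, rfl⟩ := Nat.exists_eq_succ_of_ne_zero h0
  exact ⟨i, by lia, rfl, (p.adj_getVert_succ (by lia)).symm, p.adj_getVert_succ (by lia)⟩

lemma IsPath.ncard_support {p : G.Walk u v} (hp : p.IsPath) :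
    {x | x ∈ p.support}.ncard = p.length + 1 := by
  classical
  rw [← p.length_support, ← List.toFinset_card_of_nodup hp.support_nodup,
    ← Set.ncard_coe_finset]
  simp

/-- A list of distinct consecutively adjacent vertices has at most one more vertex than a longest
path has edges. -/
lemma length_le_of_isLongestPath {p : G.Walk u v} (hp : IsLongestPath G p)
    {l : List V} (hl : l.IsChain G.Adj) (hnd : l.Nodup) : l.length ≤ p.length + 1 := by
  rcases eq_or_ne l [] with rfl | hne
  · simp
  have h := hp.2 (ofSupport l hne hl) (by rw [isPath_def, support_ofSupport]; exact hnd)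
  rw [length_ofSupport] at h
  lia

end SimpleGraph.Walk

/-- In a connected induced subgraph on `S ∪ {c, d}`, the vertex `c` has a neighbour in `S`
unless it is adjacent to `d`. -/
lemma exists_adj_of_connected_induce {V : Type*} {G : SimpleGraph V} {S : Set V} {c d : V}
    (hne : c ≠ d) (hcd : ¬ G.Adj c d) (h : (G.induce (S ∪ {c, d})).Connected) :
    ∃ s ∈ S, G.Adj c s := by
  have : Nontrivial ↥(S ∪ {c, d}) :=
    ⟨⟨c, by simp⟩, ⟨d, by simp⟩, by simpa using hne⟩
  obtain ⟨⟨w, hw⟩, hadj⟩ := h.preconnected.exists_adj_of_nontrivial ⟨c, by simp⟩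
  simp only [comap_adj, Function.Embedding.subtype_apply] at hadj
  rcases hw with hw | rfl | rfl
  · exact ⟨w, hw, hadj⟩
  · exact absurd hadj G.irrefl
  · exact absurd hadj hcd

/-- Case 2: there is no simple graph on exactly 10 vertices with longest
paths `P`, `Q` such that `V(G) = V(P) ∪ V(Q)`, `|V(P) ∩ V(Q)| = 6`, `V(P) \ V(Q)`
consists of two vertices consecutive on `P`, `V(Q) \ V(P) = {c, d}` with `cd` not an
edge of `G`, the subgraph induced on `(V(P) \ V(Q)) ∪ {c, d}` connected, and no endpoint
of `P` in `V(P) \ V(Q)` and no endpoint of `Q` in `{c, d}`. -/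
theorem statement18 {V : Type*} [Fintype V] (G : SimpleGraph V)
    (hcard : Fintype.card V = 10)
    {u₁ v₁ u₂ v₂ : V} (P : G.Walk u₁ v₁) (Q : G.Walk u₂ v₂)
    (hP : IsLongestPath G P) (hQ : IsLongestPath G Q)
    (hcover : {x | x ∈ P.support} ∪ {x | x ∈ Q.support} = Set.univ)
    (hint : ({x | x ∈ P.support} ∩ {x | x ∈ Q.support}).ncard = 6)
    (a b c d : V)
    (hab : {x | x ∈ P.support} \ {x | x ∈ Q.support} = {a, b})
    (habP : s(a, b) ∈ P.edges)
    (hcd : {x | x ∈ Q.support} \ {x | x ∈ P.support} = {c, d})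
    (hcdG : ¬ G.Adj c d)
    (hind : (G.induce (({x | x ∈ P.support} \ {x | x ∈ Q.support}) ∪ {c, d})).Connected)
    (hPa : u₁ ∉ {x | x ∈ P.support} \ {x | x ∈ Q.support})
    (hPb : v₁ ∉ {x | x ∈ P.support} \ {x | x ∈ Q.support})
    (hQc : u₂ ∉ ({c, d} : Set V)) (hQd : v₂ ∉ ({c, d} : Set V)) :
    False := by
  have hab_ne : a ≠ b := (P.adj_of_mem_edges habP).ne
  have hPlen : P.length = 7 := by
    have h1 := Set.ncard_inter_add_ncard_sdiff_eq_ncard {x | x ∈ P.support} {x | x ∈ Q.support}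
    rw [hint, hab, Set.ncard_pair hab_ne, hP.1.ncard_support] at h1
    lia
  have hcd_ne : c ≠ d := by
    rintro rfl
    have h1 := Set.ncard_union_add_ncard_inter {x | x ∈ P.support} {x | x ∈ Q.support}
    have h2 := Set.ncard_inter_add_ncard_sdiff_eq_ncard {x | x ∈ Q.support} {x | x ∈ P.support}
    rw [Set.inter_comm, hint, hcd] at h2
    rw [hcover, hint, Set.ncard_univ, Nat.card_eq_fintype_card, hcard, hP.1.ncard_support] at h1
    simp at h2
    lia
  have hc : c ∈ Q.support ∧ c ∉ P.support := by
    have : c ∈ ({c, d} : Set V) := by simp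
    rwa [← hcd] at this
  have hd : d ∈ Q.support ∧ d ∉ P.support := by
    have : d ∈ ({c, d} : Set V) := by simp
    rwa [← hcd] at this
  -- the positions of `a` and `b` on `P`
  obtain ⟨k, hk1, hk5, hkab⟩ : ∃ k, 1 ≤ k ∧ k ≤ 5 ∧
      ({a, b} : Set V) = {P.getVert k, P.getVert (k + 1)} := by
    rw [← Walk.adj_toSubgraph_iff_mem_edges, Walk.toSubgraph_adj_iff] at habP
    obtain ⟨k, hk, hlt⟩ := habP
    have hset : ({a, b} : Set V) = {P.getVert k, P.getVert (k + 1)} := by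
      rcases Sym2.eq_iff.1 hk with ⟨h1, h2⟩ | ⟨h1, h2⟩
      · rw [h1, h2]
      · rw [h1, h2, Set.pair_comm]
    rw [hab, hset] at hPa hPb
    refine ⟨k, ?_, ?_, hset⟩
    · by_contra h
      obtain rfl : k = 0 := by lia
      simp at hPa
    · by_contra h
      obtain rfl : k = 6 := by lia
      exact hPb (.inr (by simpa [hPlen] using P.getVert_length.symm))
  let f : Fin 10 → V := fun i => if (i : ℕ) < 8 then P.getVert i else if i = 8 then c else d
  have f_lt (i : Fin 10) (hi : (i : ℕ) < 8) : f i = P.getVert i := by simp [f, hi]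
  have f8 : f 8 = c := by simp [f]
  have f9 : f 9 = d := by simp [f]
  have f_inj : Function.Injective f := by
    intro i j hij
    have key (i : Fin 10) : (i : ℕ) < 8 ∨ i = 8 ∨ i = 9 := by lia
    have hPm (n : ℕ) : P.getVert n ∈ P.support := P.getVert_mem_support n
    rcases key i with hi | rfl | rfl <;> rcases key j with hj | rfl | rfl
    · rw [f_lt i hi, f_lt j hj] at hij
      exact Fin.ext (hP.1.getVert_injOn (by simp; lia) (by simp; lia) hij)
    all_goals grind
  have f_surj_P {x : V} (hx : x ∈ P.support) : ∃ i : Fin 10, i < 8 ∧ f i = x := by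
    obtain ⟨n, rfl, hn⟩ := Walk.mem_support_iff_exists_getVert.1 hx
    exact ⟨⟨n, by lia⟩, Fin.lt_def.2 (show n < 8 by lia), f_lt _ (show n < 8 by lia)⟩
  obtain ⟨K, hK⟩ : ∃ K : Fin 10, (K : ℕ) = k := ⟨⟨k, by lia⟩, rfl⟩
  have hK1 : ((K + 1 : Fin 10) : ℕ) = k + 1 := by lia
  have hfK : f K = P.getVert k := by rw [f_lt K (by lia), hK]
  have hfK1 : f (K + 1) = P.getVert (k + 1) := by rw [f_lt _ (by lia), hK1]
  rw [hkab, ← hfK, ← hfK1] at hab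
  have hKQ : f K ∉ Q.support ∧ f (K + 1) ∉ Q.support := by
    have h1 : f K ∈ ({f K, f (K + 1)} : Set V) := by simp
    have h2 : f (K + 1) ∈ ({f K, f (K + 1)} : Set V) := by simp
    rw [← hab] at h1 h2
    exact ⟨h1.2, h2.2⟩
  have attach {e : V} (he : ∃ s ∈ ({f K, f (K + 1)} : Set V), G.Adj e s) :
      ∃ s : Fin 10, (s = K ∨ s = K + 1) ∧ G.Adj e (f s) := by
    obtain ⟨s, rfl | rfl, h⟩ := he
    exacts [⟨K, .inl rfl, h⟩, ⟨K + 1, .inr rfl, h⟩]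
  rw [hab] at hind
  obtain ⟨s, hs, hcs⟩ := attach (exists_adj_of_connected_induce hcd_ne hcdG hind)
  obtain ⟨t, ht, hdt⟩ := attach (exists_adj_of_connected_induce hcd_ne.symm (fun h => hcdG h.symm)
    (by rwa [Set.pair_comm d c]))
  -- a neighbour on `Q` of `c` or `d` is a common vertex of `P` and `Q`
  have nbr {e : V} (he : e = c ∨ e = d) {n : ℕ} (hadj : G.Adj e (Q.getVert n)) :
      ∃ x : Fin 10, x < 8 ∧ x ≠ K ∧ x ≠ K + 1 ∧ f x = Q.getVert n := by
    have hQn : Q.getVert n ∈ Q.support := Q.getVert_mem_support n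
    have hPn : Q.getVert n ∈ P.support := by
      by_contra h
      have hmem : Q.getVert n ∈ ({c, d} : Set V) := by
        rw [← hcd]
        exact ⟨hQn, h⟩
      rcases he with rfl | rfl <;> rcases hmem with h' | h' <;> rw [h'] at hadj
      · exact G.irrefl hadj
      · exact hcdG hadj
      · exact hcdG hadj.symm
      · exact G.irrefl hadj
    obtain ⟨x, hx, hfx⟩ := f_surj_P hPn
    refine ⟨x, hx, ?_, ?_, hfx⟩
    · rintro rfl
      exact hKQ.1 (hfx ▸ hQn)
    · rintro rfl
      exact hKQ.2 (hfx ▸ hQn)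
  have Q_inj {m n : ℕ} (hm : m ≤ Q.length) (hn : n ≤ Q.length)
      (h : Q.getVert m = Q.getVert n) : m = n := hQ.1.getVert_injOn hm hn h
  have nbrs {e : V} (he : e = c ∨ e = d) {n : ℕ} (hn : n + 2 ≤ Q.length)
      (h0 : G.Adj e (Q.getVert n)) (h2 : G.Adj e (Q.getVert (n + 2))) :
      ∃ q ∈ commonPairs K, s(f q.1, f q.2) = s(Q.getVert n, Q.getVert (n + 2)) ∧
        G.Adj e (f q.1) ∧ G.Adj e (f q.2) := by
    obtain ⟨x, hx8, hxK, hxK1, hx⟩ := nbr he h0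
    obtain ⟨y, hy8, hyK, hyK1, hy⟩ := nbr he h2
    have hxy : x ≠ y := by
      rintro rfl
      have := Q_inj (by lia) (by lia) (hx.symm.trans hy)
      lia
    have mem_range : ∀ x : Fin 10, x < 8 → x ∈ ([0, 1, 2, 3, 4, 5, 6, 7] : List (Fin 10)) := by
      decide
    rw [← hx] at h0
    rw [← hy] at h2
    rcases lt_or_gt_of_ne hxy with h | h
    · refine ⟨(x, y), List.mem_filter.2 ⟨List.pair_mem_product.2
        ⟨mem_range x hx8, mem_range y hy8⟩, by simp [*]⟩, by rw [hx, hy], h0, h2⟩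
    · refine ⟨(y, x), List.mem_filter.2 ⟨List.pair_mem_product.2
        ⟨mem_range y hy8, mem_range x hx8⟩, by simp [*]⟩, by rw [hx, hy, Sym2.eq_swap], h2, h0⟩
  simp only [Set.mem_insert_iff, Set.mem_singleton_iff, not_or] at hQc hQd
  obtain ⟨i, hi, hic, hci, hci'⟩ :=
    Walk.exists_getVert_pred_succ hc.1 (Ne.symm hQc.1) (Ne.symm hQd.1)
  obtain ⟨j, hj, hjd, hdj, hdj'⟩ :=
    Walk.exists_getVert_pred_succ hd.1 (Ne.symm hQc.2) (Ne.symm hQd.2)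
  obtain ⟨q, hq, hqi, hcq, hcq'⟩ := nbrs (.inl rfl) hi hci hci'
  obtain ⟨r, hr, hrj, hdr, hdr'⟩ := nbrs (.inr rfl) hj hdj hdj'
  have hqr : q ≠ r := by
    rintro rfl
    have hij : i ≠ j := by
      rintro rfl
      exact hcd_ne (hic.symm.trans hjd)
    rcases Sym2.eq_iff.1 (hqi.symm.trans hrj) with ⟨h, -⟩ | ⟨h, h'⟩
    · exact hij (Q_inj (by lia) (by lia) h)
    · have := Q_inj (by lia) (by lia) h
      have := Q_inj (by lia) (by lia) h'
      lia
  have adj_of_traced {m : List (Fin 10 × List (Fin 10))}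
      (hm : ∀ p ∈ m, ∀ v ∈ p.2, G.Adj (f p.1) (f v)) {u v : Fin 10} (h : Traced m u v) :
      G.Adj (f u) (f v) := by
    have hstep {u v : Fin 10} (hu : u < 7) (h : v = u + 1) : G.Adj (f u) (f v) := by
      have hv : (v : ℕ) = u + 1 := by lia
      rw [f_lt u (by lia), f_lt v (by lia), hv]
      exact P.adj_getVert_succ (by lia)
    rcases h with ⟨hu, h⟩ | ⟨hv, h⟩ | ⟨p, hp, ⟨rfl, h⟩ | ⟨rfl, h⟩⟩
    · exact hstep hu h
    · exact (hstep hv h).symm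
    · exact hm p hp _ h
    · exact (hm p hp _ h).symm
  obtain ⟨l, hl, hchain⟩ : ∃ l ∈ ninePaths, (l.map f).IsChain G.Adj := by
    have hK15 : K ∈ ([1, 2, 3, 4, 5] : List (Fin 10)) := by
      have mem_Icc : ∀ x : Fin 10, 1 ≤ x → x ≤ 5 → x ∈ ([1, 2, 3, 4, 5] : List (Fin 10)) := by
        decide
      exact mem_Icc K (Fin.le_def.2 (by lia)) (Fin.le_def.2 (by lia))
    rcases exists_isChain_ninePaths K hK15 s (by simpa using hs) q hq with
      ⟨l, hl, h⟩ | h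
    · refine ⟨l, hl, (List.isChain_map f).2 (h.imp fun u v => adj_of_traced ?_)⟩
      simp [f8, hcs, hcq, hcq']
    · obtain ⟨l, hl, h⟩ := h t (by simpa using ht) r hr hqr
      refine ⟨l, hl, (List.isChain_map f).2 (h.imp fun u v => adj_of_traced ?_)⟩
      simp [f8, f9, hcs, hcq, hcq', hdt, hdr, hdr']
  obtain ⟨hnd, hlen⟩ := ninePaths_nodup_length l hl
  have := Walk.length_le_of_isLongestPath hP hchain (hnd.map f_inj)
  rw [List.length_map] at this
  lia
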